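/- Let X be a 0-distributive bounded G-lattice and A ⊆ X a finite subset with |A| = n ≥ 1 and ⋁A = ⊤. Then there exists a ∈ A and a finite set F ⊆ G with G = F·Δ(a) and |F| ≤ φ(n+1) (as real numbers); in particular cov(Δ(a)) ≤ φ(n+1) and p_X(a) ≥ 1/φ(n+1). -/

import Mathlib

/-- `G = F·D`: every element of `G` is a product `f * d` with `f ∈ F`, `d ∈ D`. -/
def Covers {G : Type*} [Group G] (F D : Set G) : Prop :=
  ∀ g : G, ∃ f ∈ F, ∃ d ∈ D, g = f * d

/-- The difference set `Δ(a) = {g ∈ G : (g • a) ⊓ a ≠ ⊥}`. -/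
def deltaSet (G : Type*) [Group G] {X : Type*} [Lattice X] [BoundedOrder X]
    [MulAction G X] (a : X) : Set G :=
  {g : G | (g • a) ⊓ a ≠ ⊥}

/-- The covering number of `D ⊆ G`: the least cardinality of a finite `F ⊆ G`
with `G = F·D`, and `⊤` if no such finite `F` exists. -/
noncomputable def covNum (G : Type*) [Group G] (D : Set G) : ℕ∞ :=
  sInf {c : ℕ∞ | ∃ F : Finset G, (F.card : ℕ∞) = c ∧ Covers (↑F : Set G) D}

/-- The Protasov density `p_X(a)`. -/
noncomputable def protasov (G : Type*) [Group G] {X : Type*} [Lattice X] [BoundedOrder X]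
    [MulAction G X] (a : X) : ℝ :=
  if 0 < covNum G (deltaSet G a) ∧ covNum G (deltaSet G a) < ⊤ then
    1 / ((covNum G (deltaSet G a)).toNat : ℝ)
  else 0

/-- `φ(m) = sup_{1 < x < m} (x^{m-x} - 1)/(x - 1)` (with `φ(1) = 0`, as the set is empty). -/
noncomputable def phiR (m : ℕ) : ℝ :=
  sSup ((fun x : ℝ => (x ^ ((m : ℝ) - x) - 1) / (x - 1)) '' Set.Ioo 1 (m : ℝ))

/-- The translates of the members of the family `a` by at most `h i` group elements each
have join `⊤`. -/
def TranslateCover (G : Type*) [Group G] {X ι : Type*} [Lattice X] [BoundedOrder X]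
    [MulAction G X] (a : ι → X) (h : ι → ℕ) : Prop :=
  ∃ F : ι → Finset G, (∀ i, (F i).card ≤ h i) ∧
    ∀ x : X, (∀ i, ∀ f ∈ F i, f • a i ≤ x) → x = ⊤

lemma TranslateCover.mono {G : Type*} [Group G] {X ι : Type*} [Lattice X] [BoundedOrder X]
    [MulAction G X] {a : ι → X} {h k : ι → ℕ} (H : TranslateCover G a h)
    (hk : ∀ i, h i ≤ k i) : TranslateCover G a k := by
  obtain ⟨F, hF, hx⟩ := H
  exact ⟨F, fun i => (hF i).trans (hk i), hx⟩

lemma smul_mono_of_smul_sup {G : Type*} [Group G] {X : Type*} [Lattice X] [MulAction G X]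
    (hsup : ∀ (g : G) (x y : X), g • (x ⊔ y) = g • x ⊔ g • y) (g : G) {x y : X}
    (hxy : x ≤ y) : g • x ≤ g • y := by
  rw [← sup_eq_right, ← hsup, sup_eq_right.2 hxy]

section GLattice

variable {G : Type*} [Group G] {X : Type*} [Lattice X] [BoundedOrder X] [MulAction G X]

lemma smul_top_of_smul_sup
    (hsup : ∀ (g : G) (x y : X), g • (x ⊔ y) = g • x ⊔ g • y) (g : G) :
    g • (⊤ : X) = ⊤ := by
  refine top_le_iff.1 ?_
  simpa using smul_mono_of_smul_sup hsup g (le_top : g⁻¹ • (⊤ : X) ≤ ⊤)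

lemma smul_bot_of_smul_sup
    (hsup : ∀ (g : G) (x y : X), g • (x ⊔ y) = g • x ⊔ g • y) (g : G) :
    g • (⊥ : X) = ⊥ := by
  refine le_bot_iff.1 ?_
  simpa using smul_mono_of_smul_sup hsup g (bot_le : (⊥ : X) ≤ g⁻¹ • ⊥)

lemma exists_smul_inf_eq_bot
    (hsup : ∀ (g : G) (x y : X), g • (x ⊔ y) = g • x ⊔ g • y)
    (hinf : ∀ (g : G) (x y : X), g • (x ⊓ y) = g • x ⊓ g • y)
    {a : X} {F : Finset G} (hF : ¬ Covers (↑F : Set G) (deltaSet G a)) :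
    ∃ u : G, ∀ f ∈ F, f • a ⊓ u • a = ⊥ := by
  simp only [Covers, not_forall, not_exists, not_and] at hF
  obtain ⟨u, hu⟩ := hF
  refine ⟨u, fun f hf => ?_⟩
  by_contra hne
  refine hu f hf (f⁻¹ * u) (fun h0 => hne ?_) (by group)
  have := congrArg (fun x => f • x) h0
  simpa [hinf, smul_bot_of_smul_sup hsup, smul_smul, inf_comm] using this

/-- If a cover uses a single translate of `a i₀`, every other cover using few translates of
`a i₀` can be combined with it into a cover not using `a i₀`. -/
lemma TranslateCover.eliminate
    (hsup : ∀ (g : G) (x y : X), g • (x ⊔ y) = g • x ⊔ g • y)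
    (hinf : ∀ (g : G) (x y : X), g • (x ⊓ y) = g • x ⊓ g • y)
    (h0dist : ∀ x y z : X, x ⊓ y = ⊥ → x ⊓ (y ⊔ z) = x ⊓ z)
    {ι : Type*} [DecidableEq ι] {a : ι → X} {N : ℕ} {i₀ : ι}
    (hN : ∀ F : Finset G, F.card ≤ N → ¬ Covers (↑F : Set G) (deltaSet G (a i₀)))
    {h k : ι → ℕ} (hh : TranslateCover G a h) (hk : TranslateCover G a k)
    (hh₀ : h i₀ ≤ N) (hk₀ : k i₀ ≤ 1) :
    TranslateCover G a (fun i => if i = i₀ then 0 else h i + k i) := by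
  classical
  obtain ⟨F, hF, hFx⟩ := hh
  obtain ⟨K, hK, hKx⟩ := hk
  obtain ⟨t, ht⟩ := Finset.card_le_one_iff_subset_singleton.1 ((hK i₀).trans hk₀)
  obtain ⟨u, hu⟩ := exists_smul_inf_eq_bot hsup hinf (hN (F i₀) ((hF i₀).trans hh₀))
  refine ⟨fun i => if i = i₀ then ∅ else F i ∪ (K i).image (fun f => u * t⁻¹ * f), ?_, ?_⟩
  · intro i
    dsimp only
    split_ifs
    · simp
    · exact (Finset.card_union_le _ _).trans
        (add_le_add (hF i) (Finset.card_image_le.trans (hK i)))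
  · intro x hx
    have hx' : ∀ i, i ≠ i₀ → ∀ f, f ∈ F i ∨ (∃ d ∈ K i, u * t⁻¹ * d = f) → f • a i ≤ x := by
      intro i hi f hf
      exact hx i f (by simp only [hi, if_false, Finset.mem_union, Finset.mem_image]; exact hf)
    have htop : u • a i₀ ⊔ x = ⊤ := by
      have h1 : (u * t⁻¹)⁻¹ • (u • a i₀ ⊔ x) = ⊤ := by
        refine hKx _ fun i f hf => ?_
        have h2 : (u * t⁻¹ * f) • a i ≤ u • a i₀ ⊔ x := by
          by_cases hi : i = i₀
          · subst hi
            have hft : f = t := by simpa using ht hf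
            subst hft
            simp
          · exact (hx' i hi _ (Or.inr ⟨f, hf, rfl⟩)).trans le_sup_right
        have h3 := smul_mono_of_smul_sup hsup (u * t⁻¹)⁻¹ h2
        rwa [smul_smul, inv_mul_cancel_left] at h3
      have h4 := congrArg (fun y => (u * t⁻¹) • y) h1
      simpa only [smul_inv_smul, smul_top_of_smul_sup hsup] using h4
    refine hFx x fun i f hf => ?_
    by_cases hi : i = i₀
    · subst hi
      have h5 := h0dist _ _ x (hu f hf)
      rw [htop, inf_top_eq] at h5
      exact inf_eq_left.1 h5.symm
    · exact hx' i hi f (Or.inl hf)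

lemma TranslateCover.eliminate_subset
    (hsup : ∀ (g : G) (x y : X), g • (x ⊔ y) = g • x ⊔ g • y)
    (hinf : ∀ (g : G) (x y : X), g • (x ⊓ y) = g • x ⊓ g • y)
    (h0dist : ∀ x y z : X, x ⊓ y = ⊥ → x ⊓ (y ⊔ z) = x ⊓ z)
    {ι : Type*} [DecidableEq ι] {a : ι → X} {N : ℕ}
    (hN : ∀ i, ∀ F : Finset G, F.card ≤ N → ¬ Covers (↑F : Set G) (deltaSet G (a i)))
    (hone : TranslateCover G a (fun _ => 1)) (y : ι → ℕ) (M : Finset ι)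
    (hM : ∀ b ∈ M, TranslateCover G a
      (fun i => if i = b then N else if i ∈ M then 0 else y i))
    (R : Finset ι) (hR : R ⊆ M) :
    TranslateCover G a
      (fun i => if i ∈ R then 0 else if i ∈ M then 1 else 1 + R.card * y i) := by
  induction R using Finset.induction_on with
  | empty => exact hone.mono fun i => by simp
  | insert b R hb ih =>
    have hbM : b ∈ M := hR (Finset.mem_insert_self b R)
    have ih' := ih ((Finset.subset_insert b R).trans hR)
    refine ((hM b hbM).eliminate hsup hinf h0dist (hN b) ih' (by simp)
      (by simp [hb, hbM])).mono fun i => ?_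
    rw [Finset.card_insert_of_notMem hb]
    by_cases hib : i = b
    · simp [hib]
    · by_cases hiR : i ∈ R
      · have := hR (Finset.mem_insert_of_mem hiR)
        simp [hib, hiR, this]
      · by_cases hiM : i ∈ M
        · simp [hib, hiR, hiM]
        · simp only [hib, hiR, hiM, if_false, Finset.mem_insert, or_self]
          exact le_of_eq (by ring)

end GLattice

/-- `1 + m + ⋯ + m ^ q`. -/
def geomPartial (m : ℕ) : ℕ → ℕ
  | 0 => 1
  | q + 1 => 1 + m * geomPartial m q

lemma geomPartial_mono_left {m k : ℕ} (h : m ≤ k) (q : ℕ) :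
    geomPartial m q ≤ geomPartial k q := by
  induction q with
  | zero => exact le_rfl
  | succ q ih => exact Nat.add_le_add_left (Nat.mul_le_mul h ih) 1

lemma geomPartial_le_succ (m q : ℕ) : geomPartial m q ≤ geomPartial m (q + 1) := by
  induction q with
  | zero => simp [geomPartial]
  | succ q ih => exact Nat.add_le_add_left (Nat.mul_le_mul_left m ih) 1

lemma geomPartial_zero_left (q : ℕ) : geomPartial 0 q = 1 := by
  cases q <;> simp [geomPartial]

lemma geomPartial_one_left (q : ℕ) : geomPartial 1 q = q + 1 := by
  induction q with
  | zero => rfl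
  | succ q ih => rw [geomPartial, ih]; ring

lemma geomPartial_mul_pred (m q : ℕ) :
    (geomPartial m q : ℝ) * ((m : ℝ) - 1) = (m : ℝ) ^ (q + 1) - 1 := by
  induction q with
  | zero => simp [geomPartial]
  | succ q ih =>
    rw [geomPartial]
    push_cast
    rw [pow_succ]
    linear_combination (m : ℝ) * ih

/-- `m` zeros followed by the sequence `geomPartial m` with its `j`-th term left out. -/
def coverProfile (m j p : ℕ) : ℕ :=
  if p < m then 0 else if p - m < j then geomPartial m (p - m) else geomPartial m (p - m + 1)

section Chain

variable {G : Type*} [Group G] {X : Type*} [Lattice X] [BoundedOrder X] [MulAction G X]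

/-- Every arrangement of the values `h 0, …, h (n - 1)` on the family `a` is a cover. -/
def SymmetricCover (G : Type*) [Group G] {X : Type*} [Lattice X] [BoundedOrder X]
    [MulAction G X] {n : ℕ} (a : Fin n → X) (h : ℕ → ℕ) : Prop :=
  ∀ e : Fin n → ℕ, Function.Injective e → (∀ i, e i < n) → TranslateCover G a (fun i => h (e i))

lemma card_filter_lt_of_injective {n : ℕ} {e : Fin n → ℕ} (he : Function.Injective e)
    (hlt : ∀ i, e i < n) {r : ℕ} (hr : r ≤ n) :
    (Finset.univ.filter (fun i => e i < r)).card = r := by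
  have himg : Finset.univ.image e = Finset.range n := by
    refine Finset.eq_of_subset_of_card_le ?_ ?_
    · intro x hx
      obtain ⟨i, -, rfl⟩ := Finset.mem_image.1 hx
      exact Finset.mem_range.2 (hlt i)
    · rw [Finset.card_image_of_injective _ he]; simp
  have h2 : (Finset.univ.filter (fun i => e i < r)).image e = Finset.range r := by
    ext x
    simp only [Finset.mem_image, Finset.mem_filter, Finset.mem_univ, true_and, Finset.mem_range]
    constructor
    · rintro ⟨i, hi, rfl⟩; exact hi
    · intro hx
      have : x ∈ Finset.univ.image e := by rw [himg]; exact Finset.mem_range.2 (by omega)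
      obtain ⟨i, -, rfl⟩ := Finset.mem_image.1 this
      exact ⟨i, hx, rfl⟩
  rw [← Finset.card_image_of_injective _ he, h2, Finset.card_range]

lemma SymmetricCover.eliminate
    (hsup : ∀ (g : G) (x y : X), g • (x ⊔ y) = g • x ⊔ g • y)
    (hinf : ∀ (g : G) (x y : X), g • (x ⊓ y) = g • x ⊓ g • y)
    (h0dist : ∀ x y z : X, x ⊓ y = ⊥ → x ⊓ (y ⊔ z) = x ⊓ z)
    {n : ℕ} {a : Fin n → X} {N : ℕ}
    (hN : ∀ i, ∀ F : Finset G, F.card ≤ N → ¬ Covers (↑F : Set G) (deltaSet G (a i)))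
    (hone : TranslateCover G a (fun _ => 1)) {h : ℕ → ℕ} {m : ℕ} (hm : m < n)
    (hzero : ∀ p < m, h p = 0) (hlast : h (n - 1) ≤ N) (H : SymmetricCover G a h)
    {r : ℕ} (hr : r ≤ m + 1) :
    SymmetricCover G a
      (fun p => if p < r then 0 else if p < m + 1 then 1 else 1 + r * h (p - 1)) := by
  intro e he hlt
  have key := TranslateCover.eliminate_subset hsup hinf h0dist hN hone (fun i => h (e i - 1))
    (Finset.univ.filter (fun i => e i < m + 1)) ?_ (Finset.univ.filter (fun i => e i < r)) ?_
  · rw [card_filter_lt_of_injective he hlt (by omega)] at key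
    simpa using key
  · intro b hb
    have hb' : e b < m + 1 := by simpa using hb
    refine (H (fun i => if i = b then n - 1 else if e i < e b then e i else e i - 1) ?_ ?_).mono ?_
    · intro i j hij
      dsimp only at hij
      have hi := hlt i
      have hj := hlt j
      have hne : ∀ i j, i ≠ j → e i ≠ e j := fun i j hn hn' => hn (he hn')
      by_contra hcon
      have h1 := hne _ _ hcon
      split_ifs at hij with h2 h3 h4 h5 h6 h7
      all_goals first
        | (subst_vars; exact hcon rfl)
        | (have h8 := hne i b (by assumption)
           have h9 := hne j b (by assumption)
           omega)
        | (have h8 := hne i b (by assumption)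
           omega)
        | (have h9 := hne j b (by assumption)
           omega)
    · intro i
      have hi := hlt i
      split_ifs <;> omega
    · intro i
      by_cases hib : i = b
      · simpa [hib] using hlast
      · have hne : e i ≠ e b := fun hn => hib (he hn)
        by_cases him : e i < m + 1
        · have : h (if e i < e b then e i else e i - 1) = 0 := by
            apply hzero
            split_ifs <;> omega
          simp [hib, this]
        · have : ¬ e i < e b := by omega
          simp only [hib, if_false, this, Finset.mem_filter, him, and_false, le_refl]
  · intro i hi
    have : e i < r := by simpa using hi
    simpa using this.trans_le hr

lemma symmetricCover_coverProfile
    (hsup : ∀ (g : G) (x y : X), g • (x ⊔ y) = g • x ⊔ g • y)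
    (hinf : ∀ (g : G) (x y : X), g • (x ⊓ y) = g • x ⊓ g • y)
    (h0dist : ∀ x y z : X, x ⊓ y = ⊥ → x ⊓ (y ⊔ z) = x ⊓ z)
    {n : ℕ} {a : Fin n → X} {N : ℕ}
    (hN : ∀ i, ∀ F : Finset G, F.card ≤ N → ¬ Covers (↑F : Set G) (deltaSet G (a i)))
    (hone : TranslateCover G a (fun _ => 1))
    (hs : ∀ m < n, geomPartial m (n - m) ≤ N) (m : ℕ) (hm : m ≤ n) :
    SymmetricCover G a (coverProfile m 0) := by
  induction m with
  | zero =>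
    intro e _ _
    exact hone.mono fun i => by simp [coverProfile, geomPartial_zero_left]
  | succ m ih =>
    have hzero : ∀ j, ∀ p < m, coverProfile m j p = 0 := by
      intro j p hp
      simp [coverProfile, hp]
    have hlast : ∀ j, coverProfile m j (n - 1) ≤ N := by
      intro j
      have h1 := hs m hm
      have h2 : n - 1 - m + 1 = n - m := by omega
      have h3 := geomPartial_le_succ m (n - 1 - m)
      rw [h2] at h3
      unfold coverProfile
      rw [h2]
      split_ifs <;> omega
    have hj : ∀ j ≤ n - m, SymmetricCover G a (coverProfile m j) := by
      intro j
      induction j with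
      | zero => exact fun _ => ih (by omega)
      | succ j ihj =>
        intro hjn e he hlt
        refine ((ihj (by omega)).eliminate hsup hinf h0dist hN hone hm (hzero j) (hlast j)
          (Nat.le_succ m) e he hlt).mono fun i => ?_
        generalize e i = p
        unfold coverProfile
        by_cases h1 : p < m
        · simp [h1]
        · obtain ⟨q, rfl⟩ := Nat.exists_eq_add_of_le (not_lt.1 h1)
          rcases q with _ | q
          · simp [geomPartial]
          · have h2 : m + (q + 1) - 1 = m + q := by omega
            have h3 : ¬ m + (q + 1) < m + 1 := by omega
            simp [h2, h3, geomPartial]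
            split_ifs <;> simp
    intro e he hlt
    refine ((hj (n - m) le_rfl).eliminate hsup hinf h0dist hN hone hm (hzero _) (hlast _)
      le_rfl e he hlt).mono fun i => ?_
    have hp := hlt i
    generalize e i = p at hp
    by_cases h1 : p < m + 1
    · simp [h1]
    · obtain ⟨q, rfl⟩ := Nat.exists_eq_add_of_le (not_lt.1 h1)
      have h2 : m + 1 + q - 1 = m + q := by omega
      have h3 : q < n - m := by omega
      simp only [coverProfile, h1, if_false, h2, add_tsub_cancel_left, h3, if_true,
        Nat.not_lt_zero, geomPartial, not_lt.2 (Nat.le_add_right m q)]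
      exact Nat.add_le_add_left
        (Nat.mul_le_mul_left _ (geomPartial_mono_left (Nat.le_succ m) q)) 1

lemma exists_covers_deltaSet (hbt : (⊥ : X) ≠ ⊤)
    (hsup : ∀ (g : G) (x y : X), g • (x ⊔ y) = g • x ⊔ g • y)
    (hinf : ∀ (g : G) (x y : X), g • (x ⊓ y) = g • x ⊓ g • y)
    (h0dist : ∀ x y z : X, x ⊓ y = ⊥ → x ⊓ (y ⊔ z) = x ⊓ z)
    (A : Finset X) (hA : A.sup id = ⊤) (N : ℕ)
    (hs : ∀ m < A.card, geomPartial m (A.card - m) ≤ N) :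
    ∃ a ∈ A, ∃ F : Finset G, F.card ≤ N ∧ Covers (↑F : Set G) (deltaSet G a) := by
  by_contra! hcon
  let a : Fin A.card → X := fun i => A.equivFin.symm i
  have hone : TranslateCover G a (fun _ => 1) := by
    refine ⟨fun _ => {1}, by simp, fun x hx => top_le_iff.1 ?_⟩
    rw [← hA]
    refine Finset.sup_le fun b hb => ?_
    simpa [a] using hx (A.equivFin ⟨b, hb⟩) 1 (by simp)
  have H := symmetricCover_coverProfile hsup hinf h0dist
    (fun i => hcon (a i) (A.equivFin.symm i).2) hone hs A.card le_rfl
  obtain ⟨F, hF, hx⟩ := H (fun i => i) Fin.val_injective (fun i => i.2)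
  refine hbt (hx ⊥ fun i f hf => ?_)
  have : F i = ∅ := by simpa [coverProfile] using hF i
  simp [this] at hf

end Chain

lemma bddAbove_phiR (n : ℕ) :
    BddAbove ((fun x : ℝ => (x ^ (((n + 1 : ℕ) : ℝ) - x) - 1) / (x - 1)) ''
      Set.Ioo 1 ((n + 1 : ℕ) : ℝ)) := by
  refine ⟨∑ i ∈ Finset.range n, ((n + 1 : ℕ) : ℝ) ^ i, ?_⟩
  rintro _ ⟨x, ⟨h1, h2⟩, rfl⟩
  have hx : 0 < x - 1 := by linarith
  have hle : x ^ (((n + 1 : ℕ) : ℝ) - x) ≤ x ^ n := by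
    rw [← Real.rpow_natCast]
    apply Real.rpow_le_rpow_of_exponent_le h1.le
    push_cast
    linarith
  calc (x ^ (((n + 1 : ℕ) : ℝ) - x) - 1) / (x - 1) ≤ (x ^ n - 1) / (x - 1) := by gcongr
    _ = ∑ i ∈ Finset.range n, x ^ i := (geom_sum_eq h1.ne' n).symm
    _ ≤ _ := by gcongr

lemma natCast_le_phiR (n : ℕ) (hn : 1 ≤ n) : (n : ℝ) ≤ phiR (n + 1) := by
  have hbound : ∀ x : ℝ, 1 < x → x < n + 1 → ((n : ℝ) + 1) / x - 1 ≤ phiR (n + 1) := by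
    intro x h1 h2
    have hx : 0 < x - 1 := by linarith
    refine le_trans ?_ (le_csSup (bddAbove_phiR n) ⟨x, ⟨h1, by push_cast; exact h2⟩, rfl⟩)
    rw [le_div_iff₀ hx]
    have hlog : 1 - x⁻¹ ≤ Real.log x := Real.one_sub_inv_le_log_of_pos (by linarith)
    have hexp := Real.add_one_le_exp (Real.log x * (((n + 1 : ℕ) : ℝ) - x))
    rw [Real.rpow_def_of_pos (by linarith)]
    push_cast at hexp ⊢
    have hmul : (1 - x⁻¹) * ((n : ℝ) + 1 - x) ≤ Real.log x * ((n : ℝ) + 1 - x) :=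
      mul_le_mul_of_nonneg_right hlog (by linarith)
    have heq : (((n : ℝ) + 1) / x - 1) * (x - 1) = (1 - x⁻¹) * ((n : ℝ) + 1 - x) := by
      field_simp
    linarith
  have hn' : (1 : ℝ) < n + 1 := by
    have : (1 : ℝ) ≤ n := by exact_mod_cast hn
    linarith
  have htend : Filter.Tendsto (fun x : ℝ => ((n : ℝ) + 1) / x - 1)
      (nhdsWithin 1 (Set.Ioi 1)) (nhds (((n : ℝ) + 1) / 1 - 1)) := by
    refine Filter.Tendsto.mono_left ?_ nhdsWithin_le_nhds
    exact (tendsto_const_nhds.div Filter.tendsto_id one_ne_zero).sub_const 1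
  have := le_of_tendsto htend (b := phiR (n + 1)) (by
    filter_upwards [Ioo_mem_nhdsGT hn'] with x hx using hbound x hx.1 hx.2)
  simpa using this

lemma geomPartial_le_phiR (n m : ℕ) (hm : m < n) :
    (geomPartial m (n - m) : ℝ) ≤ phiR (n + 1) := by
  have h1 := natCast_le_phiR n (by omega)
  rcases m with _ | _ | m
  · rw [geomPartial_zero_left]
    refine le_trans ?_ h1
    exact_mod_cast (by omega : 1 ≤ n)
  · rw [geomPartial_one_left]
    refine le_trans ?_ h1
    exact_mod_cast (by omega : n - (0 + 1) + 1 ≤ n)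
  · generalize hk : m + 1 + 1 = k at *
    have hk1 : (1 : ℝ) < k := by exact_mod_cast (by omega : 1 < k)
    refine le_csSup (bddAbove_phiR n) ⟨(k : ℝ), ⟨hk1, ?_⟩, ?_⟩
    · exact_mod_cast (by omega : k < n + 1)
    · have he : ((n + 1 : ℕ) : ℝ) - (k : ℝ) = ((n - k + 1 : ℕ) : ℝ) := by
        rw [← Nat.cast_sub (by omega)]
        congr 1
        omega
      dsimp only
      rw [he, Real.rpow_natCast, ← geomPartial_mul_pred]
      exact mul_div_cancel_right₀ _ (by linarith)

lemma covNum_le_card {G : Type*} [Group G] {D : Set G} {F : Finset G}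
    (h : Covers (↑F : Set G) D) : covNum G D ≤ F.card :=
  sInf_le ⟨F, rfl, h⟩

lemma covNum_pos {G : Type*} [Group G] (D : Set G) : 0 < covNum G D := by
  refine Order.one_le_iff_pos.1 (le_sInf ?_)
  rintro _ ⟨F, rfl, hF⟩
  obtain ⟨f, hf, -⟩ := hF 1
  exact_mod_cast Finset.card_pos.2 ⟨f, hf⟩

/-- For any `0`-distributive bounded `G`-lattice `X` and any `A ⊆ X` with `|A| = n ≥ 1`
and `⋁A = ⊤`, there is `a ∈ A` with a finite `F ⊆ G` such that `G = F·Δ(a)` and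
`|F| ≤ φ(n+1)`; in particular `cov(Δ(a)) ≤ φ(n+1)` and `p_X(a) ≥ 1/φ(n+1)`. -/
theorem main_theorem
    {G : Type*} [Group G] {X : Type*} [Lattice X] [BoundedOrder X] [MulAction G X]
    (hbt : (⊥ : X) ≠ ⊤)
    (hsup : ∀ (g : G) (x y : X), g • (x ⊔ y) = g • x ⊔ g • y)
    (hinf : ∀ (g : G) (x y : X), g • (x ⊓ y) = g • x ⊓ g • y)
    (h0dist : ∀ x y z : X, x ⊓ y = ⊥ → x ⊓ (y ⊔ z) = x ⊓ z)
    (n : ℕ) (hn : 1 ≤ n) (A : Finset X) (hcard : A.card = n) (hA : A.sup id = ⊤) :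
    ∃ a ∈ A,
      (∃ F : Finset G, Covers (↑F : Set G) (deltaSet G a) ∧ (F.card : ℝ) ≤ phiR (n + 1)) ∧
      covNum G (deltaSet G a) ≠ ⊤ ∧
      ((covNum G (deltaSet G a)).toNat : ℝ) ≤ phiR (n + 1) ∧
      1 / phiR (n + 1) ≤ protasov G a := by
  obtain ⟨a, ha, F, hFN, hF⟩ := exists_covers_deltaSet (G := G) hbt hsup hinf h0dist A hA
    ⌊phiR (n + 1)⌋₊ (fun m hm => Nat.le_floor (by
      rw [hcard] at hm ⊢
      exact geomPartial_le_phiR n m hm))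
  have hphi : (n : ℝ) ≤ phiR (n + 1) := natCast_le_phiR n hn
  have hFphi : (F.card : ℝ) ≤ phiR (n + 1) :=
    (Nat.cast_le.2 hFN).trans (Nat.floor_le ((Nat.cast_nonneg n).trans hphi))
  have hle := covNum_le_card hF
  have hlt : covNum G (deltaSet G a) < ⊤ := hle.trans_lt (ENat.natCast_lt_top _)
  have hpos := covNum_pos (deltaSet G a)
  have hcov : ((covNum G (deltaSet G a)).toNat : ℝ) ≤ phiR (n + 1) :=
    le_trans (Nat.cast_le.2 (ENat.toNat_le_of_le_natCast hle)) hFphi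
  have htoNat : 0 < (covNum G (deltaSet G a)).toNat :=
    Nat.pos_of_ne_zero (by simp [ENat.toNat_eq_zero, hpos.ne', hlt.ne])
  refine ⟨a, ha, ⟨F, hF, hFphi⟩, hlt.ne, hcov, ?_⟩
  rw [protasov, if_pos ⟨hpos, hlt⟩]
  exact one_div_le_one_div_of_le (Nat.cast_pos.2 htoNat) hcov
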